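/- Let κ ≥ 0, q ≥ 0, μ ∈ (0,1), let F be (λ,Λ)-elliptic, and let C > 0 be the constant (depending only on n, λ, Λ) from the uniform Lipschitz estimate for the scaled equation; set ϑ_μ := μ^{1+q}/(2C). Let ξ ∈ ℝⁿ with |ξ| ≥ κ + 2μ and ϑ ∈ (0, ϑ_μ), and let u : B₁ → ℝ with ‖u‖_{L^∞(B₁)} ≤ 1 be such that v(x) := ξ·x + ϑu(x) is a κ-grad viscosity solution in B₁ of (|Dv|−κ)₊^q F_ϑ(D²v) = ϑf, where F_ϑ(M) := ϑF(ϑ^{−1}M). Then for every ε > 0 there exists ς > 0, depending only on ε, μ, q, n, λ and Λ, such that if ‖f‖_{L^∞(B₁)} ≤ ς, then there exist a (λ,Λ)-elliptic operator 𝓕 : Sym(n) → ℝ and a continuous function h : B_{1/2} → ℝ which is a κ-grad viscosity solution of 𝓕(D²h) = 0 in B_{1/2}, with ‖u − h‖_{L^∞(B_{1/2})} ≤ ε. -/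

import Mathlib

open Metric Set Matrix MeasureTheory
open scoped RealInnerProductSpace

noncomputable section

abbrev Euc (n : ℕ) := EuclideanSpace ℝ (Fin n)

def EllMat (n : ℕ) (lam Lam : ℝ) : Set (Matrix (Fin n) (Fin n) ℝ) :=
  {A | A.IsSymm ∧ ∀ ξ : Fin n → ℝ,
      lam * (ξ ⬝ᵥ ξ) ≤ ξ ⬝ᵥ A.mulVec ξ ∧ ξ ⬝ᵥ A.mulVec ξ ≤ Lam * (ξ ⬝ᵥ ξ)}

/-- Pucci maximal operator `M⁺`. -/
def pucciSup (n : ℕ) (lam Lam : ℝ) (M : Matrix (Fin n) (Fin n) ℝ) : ℝ :=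
  sSup ((fun A => (A * M).trace) '' EllMat n lam Lam)

/-- Pucci minimal operator `M⁻`. -/
def pucciInf (n : ℕ) (lam Lam : ℝ) (M : Matrix (Fin n) (Fin n) ℝ) : ℝ :=
  sInf ((fun A => (A * M).trace) '' EllMat n lam Lam)

/-- `(λ,Λ)`-ellipticity of `F`. -/
def IsUniformlyElliptic (n : ℕ) (lam Lam : ℝ)
    (F : Matrix (Fin n) (Fin n) ℝ → ℝ) : Prop :=
  ∀ M N : Matrix (Fin n) (Fin n) ℝ, M.IsSymm → N.IsSymm →
    pucciInf n lam Lam (M - N) ≤ F M - F N ∧ F M - F N ≤ pucciSup n lam Lam (M - N)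

/-- Hessian matrix of `φ` at `x`. -/
def hess {n : ℕ} (φ : Euc n → ℝ) (x : Euc n) : Matrix (Fin n) (Fin n) ℝ :=
  fun i j => iteratedFDeriv ℝ 2 φ x ![EuclideanSpace.single i 1, EuclideanSpace.single j 1]

/-- `κ`-grad viscosity subsolution of `G(Du, D²u) = f` in `s`. -/
def GradSubSol {n : ℕ} (κ : ℝ) (G : Euc n → Matrix (Fin n) (Fin n) ℝ → ℝ)
    (f : Euc n → ℝ) (s : Set (Euc n)) (u : Euc n → ℝ) : Prop :=
  ∀ x₀ ∈ s, ∀ φ : Euc n → ℝ, ContDiff ℝ 2 φ →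
    IsLocalMax (fun x => u x - φ x) x₀ → κ < ‖gradient φ x₀‖ →
    f x₀ ≤ G (gradient φ x₀) (hess φ x₀)

/-- `κ`-grad viscosity supersolution of `G(Du, D²u) = f` in `s`. -/
def GradSupSol {n : ℕ} (κ : ℝ) (G : Euc n → Matrix (Fin n) (Fin n) ℝ → ℝ)
    (f : Euc n → ℝ) (s : Set (Euc n)) (u : Euc n → ℝ) : Prop :=
  ∀ x₀ ∈ s, ∀ φ : Euc n → ℝ, ContDiff ℝ 2 φ →
    IsLocalMin (fun x => u x - φ x) x₀ → κ < ‖gradient φ x₀‖ →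
    G (gradient φ x₀) (hess φ x₀) ≤ f x₀

/-- `κ`-grad viscosity solution. -/
def GradSol {n : ℕ} (κ : ℝ) (G : Euc n → Matrix (Fin n) (Fin n) ℝ → ℝ)
    (f : Euc n → ℝ) (s : Set (Euc n)) (u : Euc n → ℝ) : Prop :=
  GradSubSol κ G f s u ∧ GradSupSol κ G f s u

/-- Classical viscosity solution (no restriction on the slope of test functions). -/
def ViscSol {n : ℕ} (G : Euc n → Matrix (Fin n) (Fin n) ℝ → ℝ)
    (f : Euc n → ℝ) (s : Set (Euc n)) (u : Euc n → ℝ) : Prop :=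
  (∀ x₀ ∈ s, ∀ φ : Euc n → ℝ, ContDiff ℝ 2 φ →
    IsLocalMax (fun x => u x - φ x) x₀ → f x₀ ≤ G (gradient φ x₀) (hess φ x₀)) ∧
  (∀ x₀ ∈ s, ∀ φ : Euc n → ℝ, ContDiff ℝ 2 φ →
    IsLocalMin (fun x => u x - φ x) x₀ → G (gradient φ x₀) (hess φ x₀) ≤ f x₀)

/-- The operator `G(ξ, M) = (|ξ|-κ)₊^q F(M)`. -/
def mainG {n : ℕ} (κ q : ℝ) (F : Matrix (Fin n) (Fin n) ℝ → ℝ) :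
    Euc n → Matrix (Fin n) (Fin n) ℝ → ℝ :=
  fun ξ M => max (‖ξ‖ - κ) 0 ^ q * F M

/-- The set `Ω_u` of points of `s` that can be touched from above or below by a `C²`
function with slope larger than `κ`. -/
def omegaSet {n : ℕ} (κ : ℝ) (s : Set (Euc n)) (u : Euc n → ℝ) : Set (Euc n) :=
  {x ∈ s | ∃ φ : Euc n → ℝ, ContDiff ℝ 2 φ ∧
    (IsLocalMax (fun y => u y - φ y) x ∨ IsLocalMin (fun y => u y - φ y) x) ∧
    κ < ‖gradient φ x‖}

/-- Effective viscosity solution of `(|Du|-κ)₊^q F(D²u) = f` in `s`. -/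
def EffectiveSol {n : ℕ} (κ q : ℝ) (F : Matrix (Fin n) (Fin n) ℝ → ℝ)
    (f : Euc n → ℝ) (s : Set (Euc n)) (u : Euc n → ℝ) : Prop :=
  IsOpen (omegaSet κ s u) ∧ ViscSol (mainG κ q F) f (omegaSet κ s u) u

/-- The entrywise `ℓ¹` norm of a matrix. -/
def entrySum {n : ℕ} (M : Matrix (Fin n) (Fin n) ℝ) : ℝ := ∑ i, ∑ j, |M i j|

lemma entrySum_add_le {n : ℕ} (M N : Matrix (Fin n) (Fin n) ℝ) :
    entrySum (M + N) ≤ entrySum M + entrySum N := by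
  unfold entrySum
  simp only [← Finset.sum_add_distrib]
  exact Finset.sum_le_sum fun i _ => Finset.sum_le_sum fun j _ => abs_add_le _ _

lemma entrySum_smul {n : ℕ} (c : ℝ) (M : Matrix (Fin n) (Fin n) ℝ) :
    entrySum (c • M) = |c| * entrySum M := by
  simp [entrySum, abs_mul, Finset.mul_sum]

lemma entrySum_nonneg {n : ℕ} (M : Matrix (Fin n) (Fin n) ℝ) : 0 ≤ entrySum M :=
  Finset.sum_nonneg fun _ _ => Finset.sum_nonneg fun _ _ => abs_nonneg _

lemma abs_entry_le_of_mem_EllMat {n : ℕ} {lam Lam : ℝ} (hlam : 0 < lam)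
    {A : Matrix (Fin n) (Fin n) ℝ} (hA : A ∈ EllMat n lam Lam) (i j : Fin n) :
    |A i j| ≤ 2 * Lam := by
  obtain ⟨hs, hq⟩ := hA
  have hij : A j i = A i j := hs.apply i j
  have h1 := hq (Pi.single i 1)
  have h2 := hq (Pi.single j 1)
  have h3 := (hq (Pi.single i 1 + Pi.single j 1)).2
  have h4 := (hq (Pi.single i 1 - Pi.single j 1)).2
  have hle : (Pi.single i 1 : Fin n → ℝ) j ≤ 1 := by
    rw [Pi.single_apply]; split_ifs <;> norm_num
  have hge : 0 ≤ (Pi.single i 1 : Fin n → ℝ) j := by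
    rw [Pi.single_apply]; split_ifs <;> norm_num
  have hc : (Pi.single j 1 : Fin n → ℝ) i = (Pi.single i 1 : Fin n → ℝ) j := by
    simp [Pi.single_apply, eq_comm]
  simp [Matrix.mulVec_add, Matrix.mulVec_sub] at h1 h2 h3 h4
  rw [hij] at h3 h4
  rw [hc] at h3 h4
  rw [abs_le]
  constructor <;> nlinarith

lemma abs_trace_mul_le {n : ℕ} {lam Lam : ℝ} (hlam : 0 < lam)
    {A : Matrix (Fin n) (Fin n) ℝ} (hA : A ∈ EllMat n lam Lam)
    (M : Matrix (Fin n) (Fin n) ℝ) : |(A * M).trace| ≤ 2 * Lam * entrySum M := by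
  have h : (A * M).trace = ∑ j, ∑ i, A i j * M j i := by
    rw [Matrix.trace, Finset.sum_comm]
    simp [Matrix.mul_apply]
  rw [h, entrySum, Finset.mul_sum]
  refine (Finset.abs_sum_le_sum_abs _ _).trans (Finset.sum_le_sum fun j _ => ?_)
  rw [Finset.mul_sum]
  refine (Finset.abs_sum_le_sum_abs _ _).trans (Finset.sum_le_sum fun i _ => ?_)
  rw [abs_mul]
  exact mul_le_mul_of_nonneg_right (abs_entry_le_of_mem_EllMat hlam hA i j) (abs_nonneg _)

lemma IsUniformlyElliptic.abs_sub_le {n : ℕ} {lam Lam : ℝ} (hlam : 0 < lam) (hLam : lam ≤ Lam)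
    {F : Matrix (Fin n) (Fin n) ℝ → ℝ} (hF : IsUniformlyElliptic n lam Lam F)
    {M N : Matrix (Fin n) (Fin n) ℝ} (hM : M.IsSymm) (hN : N.IsSymm) :
    |F M - F N| ≤ 2 * Lam * entrySum (M - N) := by
  have hK : 0 ≤ 2 * Lam * entrySum (M - N) :=
    mul_nonneg (by linarith) (entrySum_nonneg _)
  obtain ⟨h1, h2⟩ := hF M N hM hN
  rw [abs_le]
  constructor
  · refine le_trans (Real.le_sInf ?_ (by linarith)) h1
    rintro _ ⟨A, hA, rfl⟩
    exact (abs_le.1 (abs_trace_mul_le hlam hA _)).1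
  · refine h2.trans (Real.sSup_le ?_ hK)
    rintro _ ⟨A, hA, rfl⟩
    exact (abs_le.1 (abs_trace_mul_le hlam hA _)).2

lemma pucciInf_neg {n : ℕ} (lam Lam : ℝ) (M : Matrix (Fin n) (Fin n) ℝ) :
    pucciInf n lam Lam (-M) = -pucciSup n lam Lam M := by
  have h : (fun A => (A * -M).trace) '' EllMat n lam Lam
      = -((fun A => (A * M).trace) '' EllMat n lam Lam) := by
    rw [← Set.image_neg_eq_neg, Set.image_image]
    simp
  rw [pucciInf, pucciSup, h, Real.sInf_neg]

lemma IsUniformlyElliptic.neg {n : ℕ} {lam Lam : ℝ} {F : Matrix (Fin n) (Fin n) ℝ → ℝ}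
    (hF : IsUniformlyElliptic n lam Lam F) :
    IsUniformlyElliptic n lam Lam (fun M => -F (-M)) := by
  intro M N hM hN
  have h := hF (-N) (-M) hN.neg hM.neg
  have e : -N - -M = M - N := by abel
  rw [e] at h
  exact ⟨by linarith [h.1], by linarith [h.2]⟩

lemma hess_isSymm {n : ℕ} {φ : Euc n → ℝ} (hφ : ContDiff ℝ 2 φ) (x : Euc n) :
    (hess φ x).IsSymm := by
  refine Matrix.IsSymm.ext fun i j => ?_
  have h : IsSymmSndFDerivAt ℝ φ x :=
    hφ.contDiffAt.isSymmSndFDerivAt (by simp)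
  simpa [hess, iteratedFDeriv_two_apply] using h _ _

lemma hess_add {n : ℕ} {φ ψ : Euc n → ℝ} (hφ : ContDiff ℝ 2 φ) (hψ : ContDiff ℝ 2 ψ)
    (x : Euc n) : hess (fun y => φ y + ψ y) x = hess φ x + hess ψ x := by
  ext i j
  have := iteratedFDeriv_add_apply (i := 2) (x := x) hφ.contDiffAt hψ.contDiffAt
  simp only [hess, Matrix.add_apply]
  rw [← _root_.add_apply, ← this]
  rfl

lemma hess_const_mul {n : ℕ} {φ : Euc n → ℝ} (hφ : ContDiff ℝ 2 φ) (c : ℝ)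
    (x : Euc n) : hess (fun y => c * φ y) x = c • hess φ x := by
  ext i j
  have := iteratedFDeriv_const_smul_apply (i := 2) (x := x) (a := c) hφ.contDiffAt
  simp only [hess, Matrix.smul_apply]
  rw [← _root_.smul_apply, ← this]
  rfl

lemma hess_inner {n : ℕ} (ξ x : Euc n) : hess (fun y : Euc n => ⟪ξ, y⟫) x = 0 := by
  ext i j
  have h : fderiv ℝ (fun y : Euc n => ⟪ξ, y⟫) = fun _ => innerSL ℝ ξ := by
    funext y
    exact (innerSL ℝ ξ).hasFDerivAt.fderiv
  simp [hess, iteratedFDeriv_two_apply, h]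

lemma hess_norm_sub_sq {n : ℕ} (a x : Euc n) :
    hess (fun y : Euc n => ‖y - a‖ ^ 2) x = (2 : ℝ) • 1 := by
  ext i j
  have h : fderiv ℝ (fun y : Euc n => ‖y - a‖ ^ 2) = fun y => (2 : ℝ) • innerSL ℝ (y - a) := by
    funext y
    have := ((hasFDerivAt_id (𝕜 := ℝ) y).sub_const a).norm_sq.fderiv
    simp only [id] at this
    rw [this]
    ext v
    simp
  have h2 : HasFDerivAt (fun y : Euc n => (2 : ℝ) • innerSL ℝ (y - a))
      ((2 : ℝ) • (innerSL ℝ : Euc n →L[ℝ] Euc n →L[ℝ] ℝ)) x :=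
    (((innerSL ℝ : Euc n →L[ℝ] Euc n →L[ℝ] ℝ).hasFDerivAt.comp x
      ((hasFDerivAt_id (𝕜 := ℝ) x).sub_const a)).const_smul (2 : ℝ))
  simp only [hess, iteratedFDeriv_two_apply, h, h2.fderiv]
  change (2 : ℝ) * ⟪(EuclideanSpace.single i 1 : Euc n), EuclideanSpace.single j 1⟫ = _
  rw [EuclideanSpace.inner_single_left]
  simp [Matrix.one_apply]

lemma contDiff_norm_sub_sq {n : ℕ} (a : Euc n) : ContDiff ℝ 2 (fun y : Euc n => ‖y - a‖ ^ 2) :=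
  (contDiff_id.sub contDiff_const).norm_sq ℝ

lemma continuous_hess_apply {n : ℕ} {φ : Euc n → ℝ} (hφ : ContDiff ℝ 2 φ) (i j : Fin n) :
    Continuous (fun x => hess φ x i j) := by
  have h := hφ.continuous_iteratedFDeriv (m := 2) le_rfl
  unfold hess
  exact (ContinuousMultilinearMap.apply ℝ (fun _ : Fin 2 => Euc n) ℝ _).continuous.comp h

lemma tendsto_entrySum_hess_sub {n : ℕ} {φ : Euc n → ℝ} (hφ : ContDiff ℝ 2 φ) (x : Euc n) :
    Filter.Tendsto (fun y => entrySum (hess φ y - hess φ x)) (nhds x) (nhds 0) := by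
  have h : Continuous (fun y => entrySum (hess φ y - hess φ x)) := by
    unfold entrySum
    refine continuous_finsetSum _ fun i _ => continuous_finsetSum _ fun j _ => ?_
    exact ((continuous_hess_apply hφ i j).sub continuous_const).abs
  simpa [entrySum] using h.tendsto x

lemma gradient_inner_add_mul {n : ℕ} {φ : Euc n → ℝ} (hφ : ContDiff ℝ 2 φ) (ξ x : Euc n)
    (c : ℝ) : gradient (fun y : Euc n => ⟪ξ, y⟫ + c * φ y) x = ξ + c • gradient φ x := by
  have h1 : HasGradientAt φ (gradient φ x) x :=
    (hφ.differentiable (by norm_num) x).hasGradientAt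
  have h2 : HasFDerivAt (fun y : Euc n => ⟪ξ, y⟫ + c * φ y)
      (innerSL ℝ ξ + c • InnerProductSpace.toDual ℝ (Euc n) (gradient φ x)) x :=
    (innerSL ℝ ξ).hasFDerivAt.add (h1.hasFDerivAt.const_mul c)
  have h3 := h2.hasGradientAt.gradient
  rw [h3, map_add, LinearIsometryEquiv.map_smul, LinearIsometryEquiv.symm_apply_apply]
  congr 1
  exact (InnerProductSpace.toDual ℝ (Euc n)).symm_apply_apply ξ

/-- If a function that is `L`-Lipschitz near `x` is touched from above at `x` by `φ`,
then the slope of `φ` at `x` is at most `L`. -/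
lemma norm_gradient_le_of_isLocalMax {n : ℕ} {u φ : Euc n → ℝ} {s : Set (Euc n)} {x : Euc n}
    {L : ℝ} (hL : 0 ≤ L) (hs : s ∈ nhds x)
    (hu : ∀ y ∈ s, |u x - u y| ≤ L * ‖x - y‖)
    (hφ : DifferentiableAt ℝ φ x) (hmax : IsLocalMax (fun y => u y - φ y) x) :
    ‖gradient φ x‖ ≤ L := by
  set g := gradient φ x with hg
  have hline : HasDerivAt (fun t : ℝ => x - t • g) (-g) 0 := by
    simpa using ((hasDerivAt_id (0 : ℝ)).smul_const g).const_sub x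
  have hφ' : HasFDerivAt φ (InnerProductSpace.toDual ℝ (Euc n) g) (x - (0 : ℝ) • g) := by
    rw [zero_smul, sub_zero]
    exact hφ.hasGradientAt.hasFDerivAt
  have hd : HasDerivAt (fun t : ℝ => φ (x - t • g)) (-‖g‖ ^ 2) 0 := by
    have hval : InnerProductSpace.toDual ℝ (Euc n) g (-g) = -‖g‖ ^ 2 := by simp
    rw [← hval]
    exact hφ'.comp_hasDerivAt 0 hline
  have hslope := (hasDerivWithinAt_iff_tendsto_slope' (s := Ioi 0) (by simp)).1
    (hd.hasDerivWithinAt)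
  have hx : Filter.Tendsto (fun t : ℝ => x - t • g) (nhdsWithin 0 (Ioi 0)) (nhds x) := by
    have := hline.continuousAt.tendsto
    simp only [zero_smul, sub_zero] at this
    exact this.mono_left nhdsWithin_le_nhds
  have hge : -(L * ‖g‖) ≤ -‖g‖ ^ 2 := by
    refine ge_of_tendsto hslope ?_
    filter_upwards [hx.eventually hmax, hx.eventually hs, self_mem_nhdsWithin] with t h1 h2 h3
    have h3 : 0 < t := h3
    have h4 := (abs_le.1 (hu _ h2)).2
    rw [sub_sub_cancel, norm_smul, Real.norm_eq_abs, abs_of_pos h3] at h4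
    rw [slope_def_field, le_div_iff₀ (by simpa using h3)]
    simp only [zero_smul, sub_zero]
    nlinarith
  rcases (norm_nonneg g).eq_or_lt with h0 | h0
  · rw [← h0]; exact hL
  · nlinarith

/-- Stability of viscosity subsolutions under locally uniform limits. -/
lemma viscosity_sub_of_tendsto {n : ℕ} {ι : Type*} {l : Filter ι} [l.NeBot]
    {s : Set (Euc n)} (hs : IsOpen s) {u : ι → Euc n → ℝ} {h : Euc n → ℝ}
    {F : ι → Matrix (Fin n) (Fin n) ℝ → ℝ} {Fh : Matrix (Fin n) (Fin n) ℝ → ℝ}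
    {K : ℝ} {c : ι → ℝ} (hK : 0 ≤ K)
    (hF : ∀ j M N, M.IsSymm → N.IsSymm → |F j M - F j N| ≤ K * entrySum (M - N))
    (hFh : ∀ M, M.IsSymm → Filter.Tendsto (fun j => F j M) l (nhds (Fh M)))
    (hc : Filter.Tendsto c l (nhds 0))
    (hcont : ∀ j, ContinuousOn (u j) s)
    (hu : ∀ δ > 0, ∀ᶠ j in l, ∀ x ∈ s, |u j x - h x| ≤ δ)
    (hsub : ∀ j, ∀ x ∈ s, ∀ φ : Euc n → ℝ, ContDiff ℝ 2 φ →
      IsLocalMax (fun y => u j y - φ y) x → -c j ≤ F j (hess φ x)) :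
    ∀ x ∈ s, ∀ φ : Euc n → ℝ, ContDiff ℝ 2 φ →
      IsLocalMax (fun y => h y - φ y) x → 0 ≤ Fh (hess φ x) := by
  intro x hx φ hφ hmax
  set S : ℝ := entrySum ((2 : ℝ) • (1 : Matrix (Fin n) (Fin n) ℝ))
  have key : ∀ δ > 0, -(K * (δ + δ * S)) ≤ Fh (hess φ x) := by
    intro δ hδ
    obtain ⟨r, hr, hball⟩ := Metric.nhds_basis_closedBall.mem_iff.1
      (Filter.inter_mem (Filter.inter_mem (hs.mem_nhds hx) hmax)
        ((tendsto_entrySum_hess_sub hφ x).eventually (ge_mem_nhds hδ)))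
    have hev : ∀ᶠ j in l, -c j - K * (δ + δ * S) ≤ F j (hess φ x) := by
      filter_upwards [hu (δ * r ^ 2 / 4) (by positivity)] with j hj
      have hq : ContDiff ℝ 2 (fun y : Euc n => δ * ‖y - x‖ ^ 2) :=
        contDiff_const.mul (contDiff_norm_sub_sq x)
      have hψ : ContDiff ℝ 2 (fun y => φ y + δ * ‖y - x‖ ^ 2) := hφ.add hq
      obtain ⟨z, hz, hzmax⟩ := (isCompact_closedBall x r).exists_isMaxOn
        ⟨x, mem_closedBall_self hr.le⟩
        (f := fun y => u j y - (φ y + δ * ‖y - x‖ ^ 2))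
        (((hcont j).mono fun y hy => (hball hy).1.1).sub hψ.continuous.continuousOn)
      have hzlt : z ∈ ball x r := by
        rw [mem_ball]
        refine lt_of_le_of_ne hz fun heq => ?_
        rw [dist_eq_norm] at heq
        have h1 := hzmax (mem_closedBall_self hr.le)
        have h2 := (hball hz).1.2
        have h3 := (abs_le.1 (hj z (hball hz).1.1)).2
        have h4 := (abs_le.1 (hj x hx)).1
        simp only [mem_ofPred_eq, sub_self, norm_zero, heq] at h1 h2
        have : 0 < δ * r ^ 2 := by positivity
        linarith
      have hloc : IsLocalMax (fun y => u j y - (φ y + δ * ‖y - x‖ ^ 2)) z :=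
        hzmax.isLocalMax (Filter.mem_of_superset (isOpen_ball.mem_nhds hzlt) ball_subset_closedBall)
      have h1 := hsub j z (hball hz).1.1 _ hψ hloc
      rw [hess_add hφ hq, hess_const_mul (contDiff_norm_sub_sq x), hess_norm_sub_sq] at h1
      have hsym : (hess φ z + δ • (2 : ℝ) • (1 : Matrix (Fin n) (Fin n) ℝ)).IsSymm :=
        (hess_isSymm hφ z).add ((Matrix.isSymm_one.smul _).smul _)
      have h2 := (abs_le.1 (hF j _ _ hsym (hess_isSymm hφ x))).2
      have h3 : entrySum (hess φ z + δ • (2 : ℝ) • (1 : Matrix (Fin n) (Fin n) ℝ) - hess φ x)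
          ≤ δ + δ * S := by
        rw [add_sub_right_comm]
        refine (entrySum_add_le _ _).trans (add_le_add (hball hz).2 ?_)
        rw [entrySum_smul, abs_of_pos hδ]
      have h4 := mul_le_mul_of_nonneg_left h3 hK
      linarith
    have hlim := (hc.neg.sub_const (K * (δ + δ * S)))
    simpa using le_of_tendsto_of_tendsto hlim (hFh _ (hess_isSymm hφ x)) hev
  have hlim : Filter.Tendsto (fun δ : ℝ => -(K * (δ + δ * S))) (nhdsWithin 0 (Ioi 0)) (nhds 0) := by
    have : Continuous (fun δ : ℝ => -(K * (δ + δ * S))) := by fun_prop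
    simpa using (this.tendsto 0).mono_left nhdsWithin_le_nhds
  exact le_of_tendsto hlim (eventually_mem_nhdsWithin.mono key)

/-- Far from the critical slope, the degenerate inequality for `ξ·x + ϑu` gives a uniformly
elliptic one for `u`. -/
lemma GradSubSol.le_of_slope {n : ℕ} {κ q ϑ μ L ς : ℝ} {ξ : Euc n} {u f : Euc n → ℝ}
    {F : Matrix (Fin n) (Fin n) ℝ → ℝ} (hq : 0 ≤ q) (hϑ : 0 < ϑ) (hμ : 0 < μ) (hL : 0 ≤ L)
    (hϑL : ϑ * L ≤ μ) (hς : 0 ≤ ς) (hξ : κ + 2 * μ ≤ ‖ξ‖)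
    (hlip : ∀ x ∈ ball (0 : Euc n) (1/2), ∀ y ∈ ball (0 : Euc n) (1/2),
      |u x - u y| ≤ L * ‖x - y‖)
    (hf : ∀ x ∈ ball (0 : Euc n) 1, |f x| ≤ ς)
    (hsub : GradSubSol κ (mainG κ q (fun M => ϑ * F (ϑ⁻¹ • M))) (fun x => ϑ * f x)
      (ball 0 1) (fun x => ⟪ξ, x⟫ + ϑ * u x)) :
    ∀ x ∈ ball (0 : Euc n) (1/2), ∀ φ : Euc n → ℝ, ContDiff ℝ 2 φ →
      IsLocalMax (fun y => u y - φ y) x → -(ς * μ ^ (-q)) ≤ F (hess φ x) := by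
  intro x hx φ hφ hmax
  have hx1 : x ∈ ball (0 : Euc n) 1 := ball_subset_ball (by norm_num) hx
  have hg : ‖gradient φ x‖ ≤ L := norm_gradient_le_of_isLocalMax hL (isOpen_ball.mem_nhds hx)
    (hlip x hx) (hφ.differentiable (by norm_num) x) hmax
  have hin : ContDiff ℝ 2 (fun y : Euc n => ⟪ξ, y⟫) := (innerSL ℝ ξ).contDiff
  have hm : ContDiff ℝ 2 (fun y : Euc n => ϑ * φ y) := contDiff_const.mul hφ
  have hloc : IsLocalMax (fun y => (⟪ξ, y⟫ + ϑ * u y) - (⟪ξ, y⟫ + ϑ * φ y)) x := by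
    filter_upwards [hmax] with y hy
    nlinarith
  have hslope : κ + μ ≤ ‖ξ + ϑ • gradient φ x‖ := by
    have h1 := norm_sub_le (ξ + ϑ • gradient φ x) (ϑ • gradient φ x)
    rw [add_sub_cancel_right, norm_smul, Real.norm_eq_abs, abs_of_pos hϑ] at h1
    have := mul_le_mul_of_nonneg_left hg hϑ.le
    linarith
  have h := hsub x hx1 _ (hin.add hm) hloc
    (by rw [gradient_inner_add_mul hφ]; linarith)
  rw [gradient_inner_add_mul hφ, hess_add hin hm, hess_inner, hess_const_mul hφ, zero_add] at h
  simp only [mainG, inv_smul_smul₀ hϑ.ne'] at h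
  set T := ‖ξ + ϑ • gradient φ x‖
  have hT : μ ^ q ≤ max (T - κ) 0 ^ q :=
    Real.rpow_le_rpow hμ.le (le_max_of_le_left (by linarith)) hq
  have h' : f x ≤ max (T - κ) 0 ^ q * F (hess φ x) := by
    refine le_of_mul_le_mul_left ?_ hϑ
    linarith
  have hfx := (abs_le.1 (hf x hx1)).1
  have hpos : 0 < μ ^ q := Real.rpow_pos_of_pos hμ q
  rw [Real.rpow_neg hμ.le, ← div_eq_mul_inv, neg_le, div_eq_mul_inv, ← neg_le, ← div_eq_mul_inv,
    ← neg_div, div_le_iff₀ hpos]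
  rcases le_total 0 (F (hess φ x)) with h0 | h0 <;> nlinarith

lemma GradSupSol.neg {n : ℕ} {κ q ϑ : ℝ} {ξ : Euc n} {u f : Euc n → ℝ}
    {F : Matrix (Fin n) (Fin n) ℝ → ℝ} {s : Set (Euc n)}
    (h : GradSupSol κ (mainG κ q (fun M => ϑ * F (ϑ⁻¹ • M))) (fun x => ϑ * f x)
      s (fun x => ⟪ξ, x⟫ + ϑ * u x)) :
    GradSubSol κ (mainG κ q (fun M => ϑ * (fun N => -F (-N)) (ϑ⁻¹ • M))) (fun x => ϑ * -f x)
      s (fun x => ⟪-ξ, x⟫ + ϑ * -u x) := by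
  intro x hx φ hφ hmax hslope
  have hgrad : gradient (fun y => -1 * φ y) x = -gradient φ x := by
    have := gradient_inner_add_mul hφ 0 x (-1)
    simpa using this
  have hh := h x hx (fun y => -1 * φ y) (contDiff_const.mul hφ) (by
    filter_upwards [hmax] with y hy
    simp only [inner_neg_left] at hy
    linarith) (by rw [hgrad, norm_neg]; exact hslope)
  rw [hgrad, hess_const_mul hφ] at hh
  simp only [mainG, norm_neg, neg_smul, one_smul, smul_neg] at hh ⊢
  linarith

/-- A bounded function satisfying a viscosity inequality bounds the operator at the origin. -/
lemma le_apply_zero_of_viscosity_sub {n : ℕ} {K c : ℝ} {u : Euc n → ℝ}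
    {F : Matrix (Fin n) (Fin n) ℝ → ℝ}
    (hF : ∀ M N, M.IsSymm → N.IsSymm → |F M - F N| ≤ K * entrySum (M - N))
    (hu : ∀ x ∈ ball (0 : Euc n) (1/2), |u x| ≤ 1) (hcont : ContinuousOn u (ball 0 (1/2)))
    (hsub : ∀ x ∈ ball (0 : Euc n) (1/2), ∀ φ : Euc n → ℝ, ContDiff ℝ 2 φ →
      IsLocalMax (fun y => u y - φ y) x → -c ≤ F (hess φ x)) :
    -(c + K * entrySum ((64 : ℝ) • (2 : ℝ) • (1 : Matrix (Fin n) (Fin n) ℝ))) ≤ F 0 := by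
  have hφ : ContDiff ℝ 2 (fun y : Euc n => 64 * ‖y - 0‖ ^ 2) :=
    contDiff_const.mul (contDiff_norm_sub_sq 0)
  have hsubset : closedBall (0 : Euc n) (1/4) ⊆ ball 0 (1/2) :=
    closedBall_subset_ball (by norm_num)
  have h0 : (0 : Euc n) ∈ closedBall (0 : Euc n) (1/4) := mem_closedBall_self (by norm_num)
  obtain ⟨z, hz, hzmax⟩ := (isCompact_closedBall (0 : Euc n) (1/4)).exists_isMaxOn ⟨0, h0⟩
    (f := fun y => u y - 64 * ‖y - 0‖ ^ 2)
    ((hcont.mono hsubset).sub hφ.continuous.continuousOn)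
  have hzlt : z ∈ ball (0 : Euc n) (1/4) := by
    rw [mem_ball]
    refine lt_of_le_of_ne hz fun heq => ?_
    rw [dist_eq_norm] at heq
    have h1 := hzmax h0
    have h2 := (abs_le.1 (hu z (hsubset hz))).2
    have h3 := (abs_le.1 (hu 0 (hsubset h0))).1
    simp only [mem_ofPred_eq, sub_self, norm_zero, heq] at h1
    norm_num at h1
    linarith
  have h1 := hsub z (hsubset hz) _ hφ (hzmax.isLocalMax
    (Filter.mem_of_superset (isOpen_ball.mem_nhds hzlt) ball_subset_closedBall))
  rw [hess_const_mul (contDiff_norm_sub_sq 0), hess_norm_sub_sq] at h1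
  have h2 := (abs_le.1 (hF ((64 : ℝ) • (2 : ℝ) • 1) 0
    ((Matrix.isSymm_one.smul _).smul _) Matrix.isSymm_zero)).2
  rw [sub_zero] at h2
  linarith

lemma Ultrafilter.exists_tendsto_of_abs_le {ι : Type*} (U : Ultrafilter ι) {a : ι → ℝ} {R : ℝ}
    (ha : ∀ j, |a j| ≤ R) : ∃ b, Filter.Tendsto a U (nhds b) := by
  obtain ⟨b, -, hb⟩ := (isCompact_Icc (a := -R) (b := R)).ultrafilter_le_nhds (U.map a) (by
    rw [Filter.le_principal_iff]
    exact (Filter.Eventually.of_forall fun j => abs_le.1 (ha j) : ∀ᶠ j in (U : Filter ι), a j ∈ Icc (-R) R))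
  exact ⟨b, hb⟩

/-- A pointwise limit of equi-Lipschitz functions on a totally bounded set is Lipschitz, and the
convergence is uniform. -/
lemma lipschitz_and_uniform_of_tendsto {n : ℕ} {ι : Type*} {l : Filter ι} [l.NeBot]
    {s : Set (Euc n)} (hs : TotallyBounded s) {u : ι → Euc n → ℝ} {h : Euc n → ℝ} {L : ℝ}
    (hL : 0 ≤ L) (hlip : ∀ j, ∀ x ∈ s, ∀ y ∈ s, |u j x - u j y| ≤ L * ‖x - y‖)
    (hlim : ∀ x ∈ s, Filter.Tendsto (fun j => u j x) l (nhds (h x))) :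
    (∀ x ∈ s, ∀ y ∈ s, |h x - h y| ≤ L * ‖x - y‖) ∧
      ∀ δ > 0, ∀ᶠ j in l, ∀ x ∈ s, |u j x - h x| ≤ δ := by
  have hh : ∀ x ∈ s, ∀ y ∈ s, |h x - h y| ≤ L * ‖x - y‖ := fun x hx y hy =>
    le_of_tendsto ((hlim x hx).sub (hlim y hy)).abs
      (Filter.Eventually.of_forall fun j => hlip j x hx y hy)
  refine ⟨hh, fun δ hδ => ?_⟩
  have hη : 0 < δ / (3 * (L + 1)) := by positivity
  obtain ⟨t, hts, htf, hcov⟩ := Metric.finite_approx_of_totallyBounded hs _ hη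
  have hev : ∀ᶠ j in l, ∀ y ∈ t, |u j y - h y| < δ / 3 := by
    rw [Filter.eventually_all_finite htf]
    intro y hy
    have := (Metric.tendsto_nhds.1 (hlim y (hts hy))) (δ / 3) (by positivity)
    simpa [Real.dist_eq] using this
  filter_upwards [hev] with j hj x hx
  obtain ⟨y, hy, hxy⟩ := mem_iUnion₂.1 (hcov hx)
  rw [mem_ball, dist_eq_norm] at hxy
  have h1 : L * ‖x - y‖ ≤ δ / 3 := by
    have : (L + 1) * (δ / (3 * (L + 1))) = δ / 3 := by field_simp
    rw [← this]
    exact mul_le_mul (by linarith) hxy.le (norm_nonneg _) (by linarith)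
  have h2 := abs_le.1 (hlip j x hx y (hts hy))
  have h3 := abs_le.1 (hh x hx y (hts hy))
  have h4 := abs_lt.1 (hj y hy)
  rw [abs_le]
  constructor <;> linarith [h2.1, h2.2, h3.1, h3.2, h4.1, h4.2]

/-- Lemma 5.6, compactness / approximation by `κ`-grad `F`-harmonic
functions far from the free boundary. Here `C` is the constant from the uniform
Lipschitz estimate for the scaled equation. -/
theorem compactness_far_from_FB
    (n : ℕ) (hn : 1 ≤ n) (lam Lam : ℝ) (hlam : 0 < lam) (hlamLam : lam ≤ Lam)
    (q μ : ℝ) (hq : 0 ≤ q) (hμ : μ ∈ Ioo (0 : ℝ) 1)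
    (C : ℝ) (hCpos : 0 < C)
    (hC : ∀ F : Matrix (Fin n) (Fin n) ℝ → ℝ, IsUniformlyElliptic n lam Lam F →
      ∀ κ' q' ϑ' μ' : ℝ, 0 ≤ κ' → 0 ≤ q' → 0 < ϑ' → μ' ∈ Ioo (0 : ℝ) 1 →
      ∀ ξ : Euc n, ∀ u f : Euc n → ℝ,
        (∀ x ∈ ball (0 : Euc n) 1, |u x| ≤ 1) →
        (∀ x ∈ ball (0 : Euc n) 1, |f x| ≤ 1) →
        ContinuousOn u (ball 0 1) → ContinuousOn f (ball 0 1) →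
        GradSol κ' (mainG κ' q' (fun M => ϑ' * F (ϑ'⁻¹ • M))) (fun x => ϑ' * f x)
          (ball 0 1) (fun x => ⟪ξ, x⟫ + ϑ' * u x) →
        κ' + 2 * μ' ≤ ‖ξ‖ → ϑ' ≤ μ' ^ (q' + 1) / (2 * C) →
        ∀ x ∈ ball (0 : Euc n) (1/2), ∀ y ∈ ball (0 : Euc n) (1/2),
          |u x - u y| ≤ C * μ' ^ (-q') * ‖x - y‖) :
    ∀ ε > 0, ∃ ς > 0,
      ∀ F : Matrix (Fin n) (Fin n) ℝ → ℝ, IsUniformlyElliptic n lam Lam F →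
      ∀ κ : ℝ, 0 ≤ κ → ∀ ϑ : ℝ, 0 < ϑ → ϑ < μ ^ (1 + q) / (2 * C) →
      ∀ ξ : Euc n, κ + 2 * μ ≤ ‖ξ‖ →
      ∀ u f : Euc n → ℝ,
        (∀ x ∈ ball (0 : Euc n) 1, |u x| ≤ 1) →
        (∀ x ∈ ball (0 : Euc n) 1, |f x| ≤ ς) →
        ContinuousOn u (ball 0 1) → ContinuousOn f (ball 0 1) →
        GradSol κ (mainG κ q (fun M => ϑ * F (ϑ⁻¹ • M))) (fun x => ϑ * f x)
          (ball 0 1) (fun x => ⟪ξ, x⟫ + ϑ * u x) →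
        ∃ Fh : Matrix (Fin n) (Fin n) ℝ → ℝ, ∃ h : Euc n → ℝ,
          IsUniformlyElliptic n lam Lam Fh ∧
          ContinuousOn h (ball 0 (1/2)) ∧
          GradSol κ (fun _ M => Fh M) (fun _ => 0) (ball 0 (1/2)) h ∧
          ∀ x ∈ ball (0 : Euc n) (1/2), |u x - h x| ≤ ε := by
  by_contra hcon
  push Not at hcon
  obtain ⟨ε, hε, hcon⟩ := hcon
  obtain ⟨hμ0, hμ1⟩ := hμ
  set L : ℝ := C * μ ^ (-q) with hLdef
  have hμq : 0 < μ ^ (-q) := Real.rpow_pos_of_pos hμ0 _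
  have hL : 0 ≤ L := by positivity
  have hK : 0 ≤ 2 * Lam := by linarith
  have key : ∀ j : ℕ, ∃ (F : Matrix (Fin n) (Fin n) ℝ → ℝ) (κ : ℝ) (u : Euc n → ℝ),
      IsUniformlyElliptic n lam Lam F ∧
      (∀ x ∈ ball (0 : Euc n) (1/2), |u x| ≤ 1) ∧
      ContinuousOn u (ball 0 (1/2)) ∧
      (∀ x ∈ ball (0 : Euc n) (1/2), ∀ y ∈ ball (0 : Euc n) (1/2),
        |u x - u y| ≤ L * ‖x - y‖) ∧
      (∀ x ∈ ball (0 : Euc n) (1/2), ∀ φ : Euc n → ℝ, ContDiff ℝ 2 φ →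
        IsLocalMax (fun y => u y - φ y) x →
          -(1 / ((j : ℝ) + 1) * μ ^ (-q)) ≤ F (hess φ x)) ∧
      (∀ x ∈ ball (0 : Euc n) (1/2), ∀ φ : Euc n → ℝ, ContDiff ℝ 2 φ →
        IsLocalMax (fun y => -u y - φ y) x →
          -(1 / ((j : ℝ) + 1) * μ ^ (-q)) ≤ -F (-hess φ x)) ∧
      ∀ (Fh : Matrix (Fin n) (Fin n) ℝ → ℝ) (h : Euc n → ℝ), IsUniformlyElliptic n lam Lam Fh →
        ContinuousOn h (ball 0 (1/2)) →
        GradSol κ (fun _ M => Fh M) (fun _ => 0) (ball 0 (1/2)) h →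
        ∃ x ∈ ball (0 : Euc n) (1/2), ε < |u x - h x| := by
    intro j
    have hς : (0 : ℝ) < 1 / ((j : ℝ) + 1) := Nat.one_div_pos_of_nat
    have hς1 : 1 / ((j : ℝ) + 1) ≤ 1 := by
      rw [div_le_one (by positivity)]
      linarith [(Nat.cast_nonneg j : (0 : ℝ) ≤ j)]
    obtain ⟨F, hF, κ, hκ, ϑ, hϑ, hϑlt, ξ, hξ, u, f, hu, hf, huc, hfc, hsol, hno⟩ := hcon _ hς
    have hsub : ball (0 : Euc n) (1/2) ⊆ ball 0 1 := ball_subset_ball (by norm_num)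
    have hlip := hC F hF κ q ϑ μ hκ hq hϑ ⟨hμ0, hμ1⟩ ξ u f hu
      (fun x hx => (hf x hx).trans hς1) huc hfc hsol hξ (by rw [add_comm q 1]; exact hϑlt.le)
    have hϑL : ϑ * L ≤ μ := by
      have h1 := mul_le_mul_of_nonneg_right hϑlt.le hL
      have h2 : μ ^ (1 + q) / (2 * C) * L = μ / 2 := by
        rw [hLdef, Real.rpow_add hμ0, Real.rpow_neg hμ0.le, Real.rpow_one]
        have := (Real.rpow_pos_of_pos hμ0 q).ne'
        field_simp
      linarith
    refine ⟨F, κ, u, hF, fun x hx => hu x (hsub hx), huc.mono hsub, hlip,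
      hsol.1.le_of_slope hq hϑ hμ0 hL hϑL hς.le hξ hlip hf,
      hsol.2.neg.le_of_slope (F := fun N => -F (-N)) hq hϑ hμ0 hL hϑL hς.le (by rwa [norm_neg]) ?_ ?_, ?_⟩
    · intro x hx y hy
      rw [neg_sub_neg, abs_sub_comm]
      exact hlip x hx y hy
    · intro x hx
      rw [abs_neg]
      exact hf x hx
    · exact fun Fh h h1 h2 h3 => hno Fh h h1 h2 h3
  choose F κ u hF hu huc hlip hsub hsup hno using key
  set c : ℕ → ℝ := fun j => 1 / ((j : ℝ) + 1) * μ ^ (-q) with hcdef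
  have hFlip : ∀ j M N, M.IsSymm → N.IsSymm → |F j M - F j N| ≤ 2 * Lam * entrySum (M - N) :=
    fun j M N hM hN => (hF j).abs_sub_le hlam hlamLam hM hN
  have hFneg : ∀ j M N, M.IsSymm → N.IsSymm →
      |(-F j (-M)) - (-F j (-N))| ≤ 2 * Lam * entrySum (M - N) :=
    fun j M N hM hN => (hF j).neg.abs_sub_le hlam hlamLam hM hN
  set U : Ultrafilter ℕ := Filter.hyperfilter ℕ
  have hU : (U : Filter ℕ) ≤ Filter.atTop := Nat.hyperfilter_le_atTop
  have hc : Filter.Tendsto c U (nhds 0) := by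
    have := (tendsto_one_div_add_atTop_nhds_zero_nat (𝕜 := ℝ)).mul_const (μ ^ (-q))
    rw [zero_mul] at this
    exact this.mono_left hU
  have hcle : ∀ j, c j ≤ μ ^ (-q) := fun j => by
    refine mul_le_of_le_one_left hμq.le ?_
    rw [div_le_one (by positivity)]
    linarith [(Nat.cast_nonneg j : (0 : ℝ) ≤ j)]
  have hlimu : ∀ x, ∃ b, x ∈ ball (0 : Euc n) (1/2) →
      Filter.Tendsto (fun j => u j x) U (nhds b) := fun x => by
    by_cases hx : x ∈ ball (0 : Euc n) (1/2)
    · obtain ⟨b, hb⟩ := U.exists_tendsto_of_abs_le fun j => hu j x hx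
      exact ⟨b, fun _ => hb⟩
    · exact ⟨0, fun h => absurd h hx⟩
  choose h hh using hlimu
  have hlimF : ∀ M : Matrix (Fin n) (Fin n) ℝ, ∃ b, M.IsSymm →
      Filter.Tendsto (fun j => F j M) U (nhds b) := fun M => by
    by_cases hM : M.IsSymm
    · set R := μ ^ (-q) + 2 * Lam *
        entrySum ((64 : ℝ) • (2 : ℝ) • (1 : Matrix (Fin n) (Fin n) ℝ)) with hR
      obtain ⟨b, hb⟩ := U.exists_tendsto_of_abs_le (a := fun j => F j M)
        (R := R + 2 * Lam * entrySum M) fun j => by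
          have h1 := le_apply_zero_of_viscosity_sub (hFlip j) (hu j) (huc j) (hsub j)
          have h2 := le_apply_zero_of_viscosity_sub (u := fun x => -u j x)
            (F := fun N => -F j (-N)) (hFneg j)
            (fun x hx => by rw [abs_neg]; exact hu j x hx) (huc j).neg (hsup j)
          have h3 := abs_le.1 (hFlip j M 0 hM Matrix.isSymm_zero)
          rw [sub_zero] at h3
          rw [neg_zero] at h2
          have h4 : 1 / ((j : ℝ) + 1) * μ ^ (-q) ≤ μ ^ (-q) := hcle j
          rw [abs_le]
          constructor <;> linarith [h3.1, h3.2]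
      exact ⟨b, fun _ => hb⟩
    · exact ⟨0, fun h => absurd h hM⟩
  choose Fh hFh using hlimF
  obtain ⟨hhlip, hunif⟩ := lipschitz_and_uniform_of_tendsto
    ((isCompact_closedBall (0 : Euc n) (1/2)).totallyBounded.subset ball_subset_closedBall) hL hlip hh
  have hell : IsUniformlyElliptic n lam Lam Fh := fun M N hM hN =>
    ⟨ge_of_tendsto ((hFh M hM).sub (hFh N hN))
      (Filter.Eventually.of_forall fun j => (hF j M N hM hN).1),
     le_of_tendsto ((hFh M hM).sub (hFh N hN))
      (Filter.Eventually.of_forall fun j => (hF j M N hM hN).2)⟩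
  have hhc : ContinuousOn h (ball 0 (1/2)) := by
    refine (LipschitzOnWith.of_dist_le_mul (K := ⟨L, hL⟩) fun x hx y hy => ?_).continuousOn
    rw [Real.dist_eq, dist_eq_norm]
    exact hhlip x hx y hy
  have hlimsub := viscosity_sub_of_tendsto isOpen_ball hK hFlip hFh hc huc hunif hsub
  have hlimsup := viscosity_sub_of_tendsto (u := fun j x => -u j x) (h := fun x => -h x)
    (F := fun j M => -F j (-M)) (Fh := fun M => -Fh (-M)) isOpen_ball hK hFneg
    (fun M hM => (hFh (-M) hM.neg).neg) hc (fun j => (huc j).neg)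
    (fun δ hδ => by
      filter_upwards [hunif δ hδ] with j hj x hx
      rw [neg_sub_neg, abs_sub_comm]
      exact hj x hx) hsup
  have hsol : ∀ κ, GradSol κ (fun _ M => Fh M) (fun _ => 0) (ball 0 (1/2)) h := by
    refine fun κ => ⟨fun x hx φ hφ hmax _ => hlimsub x hx φ hφ hmax,
      fun x hx φ hφ hmin _ => ?_⟩
    have := hlimsup x hx (fun y => -1 * φ y) (contDiff_const.mul hφ) (by
      filter_upwards [hmin] with y hy
      linarith)
    rw [hess_const_mul hφ, neg_smul, one_smul, neg_neg] at this
    linarith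
  obtain ⟨j, hj⟩ := (hunif ε hε).exists
  obtain ⟨x, hx, hlt⟩ := hno j Fh h hell hhc (hsol (κ j))
  exact absurd (hj x hx) (not_le.2 hlt)

end
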